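/- Let U = Σ_{i=1}^N U_i satisfy Assumption S3 with constant M̃ > 0 and points x_1*, …, x_N* with ∇U_i(x_i*) = 0. Let 1 ≤ n ≤ N and let τ be a uniform random n-subset of {1, …, N}. Then for every x ∈ ℝ^d, E_τ |(N/n)·Σ_{i∈τ} ∇U_i(x) − ∇U(x)|² ≤ 2·((N − n)/n)·M̃²·Σ_{i=1}^N |x − x_i*|². In particular the second moment of the naive stochastic gradient error scales like N(N − n)/n when the x_i* stay at bounded distance from one another. -/

import Mathlib

open Finset

/-- A sum of differentiable functions has as gradient the sum of the gradients. -/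
lemma gradient_fun_sum {ι E : Type*} [Fintype ι] [NormedAddCommGroup E] [InnerProductSpace ℝ E]
    [CompleteSpace E] {f : ι → E → ℝ} {x : E} (hf : ∀ i, DifferentiableAt ℝ (f i) x) :
    gradient (fun z => ∑ i, f i z) x = ∑ i, gradient (f i) x := by
  simp only [gradient]
  rw [fderiv_fun_sum fun i _ => hf i, map_sum]

section SubsetSums

variable {ι : Type*} [Fintype ι] [DecidableEq ι]

lemma card_mul_card_filter_mem_powersetCard (n : ℕ) (i : ι) :
    Fintype.card ι * #{s ∈ powersetCard n (univ : Finset ι) | i ∈ s}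
      = (Fintype.card ι).choose n * n := by
  rcases n with _ | n
  · simp
  have h := card_filter_powersetCard_subset {i} univ (n + 1) (subset_univ _) (by simp)
  simp only [singleton_subset_iff, card_univ, card_singleton, Nat.add_sub_cancel] at h
  obtain ⟨m, hm⟩ := Nat.exists_eq_add_one.2 (Fintype.card_pos_iff.2 ⟨i⟩)
  rw [h, hm, Nat.add_sub_cancel, Nat.add_one_mul_choose_eq]

lemma card_mul_card_filter_mem_mem_powersetCard (n : ℕ) (i j : ι) :
    (Fintype.card ι : ℝ) * (Fintype.card ι - 1)
        * #{s ∈ powersetCard n (univ : Finset ι) | i ∈ s ∧ j ∈ s}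
      = (Fintype.card ι).choose n * n * (n - 1)
        + if i = j then ((Fintype.card ι).choose n * n * (Fintype.card ι - n) : ℝ) else 0 := by
  split_ifs with hij
  · subst hij
    have h : (Fintype.card ι : ℝ) * #{s ∈ powersetCard n (univ : Finset ι) | i ∈ s}
        = (Fintype.card ι).choose n * n := by
      exact_mod_cast card_mul_card_filter_mem_powersetCard n i
    simp only [and_self]
    linear_combination ((Fintype.card ι : ℝ) - 1) * h
  · obtain hn | hn := lt_or_ge n 2
    · have h : {s ∈ powersetCard n (univ : Finset ι) | i ∈ s ∧ j ∈ s} = ∅ := by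
        refine filter_eq_empty_iff.2 fun s hs hmem => ?_
        have := one_lt_card.2 ⟨i, hmem.1, j, hmem.2, hij⟩
        have := mem_powersetCard_univ.1 hs
        omega
      rw [h]
      interval_cases n <;> simp
    · obtain ⟨k, rfl⟩ := Nat.exists_eq_add_of_le' hn
      have h := card_filter_powersetCard_subset {i, j} univ (k + 2) (subset_univ _)
        (by simp [card_pair hij])
      simp only [insert_subset_iff, singleton_subset_iff, card_univ, card_pair hij,
        Nat.add_sub_cancel] at h
      have hcard : 2 ≤ Fintype.card ι := by
        simpa [card_pair hij] using card_le_univ ({i, j} : Finset ι)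
      obtain ⟨m, hm⟩ := Nat.exists_eq_add_of_le' hcard
      rw [h, hm, Nat.add_sub_cancel]
      have h₁ : ((m : ℝ) + 1) * m.choose k = (m + 1).choose (k + 1) * (k + 1) := by
        exact_mod_cast Nat.add_one_mul_choose_eq m k
      have h₂ : ((m : ℝ) + 2) * (m + 1).choose (k + 1) = (m + 2).choose (k + 2) * (k + 2) := by
        exact_mod_cast Nat.add_one_mul_choose_eq (m + 1) (k + 1)
      push_cast
      linear_combination ((m : ℝ) + 2) * h₁ + ((k : ℝ) + 1) * h₂

variable {E : Type*} [NormedAddCommGroup E] [InnerProductSpace ℝ E]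

lemma card_smul_sum_powersetCard_sum (n : ℕ) (v : ι → E) :
    (Fintype.card ι : ℝ) • ∑ s ∈ powersetCard n (univ : Finset ι), ∑ i ∈ s, v i
      = ((Fintype.card ι).choose n * n : ℝ) • ∑ i, v i := by
  have h (s : Finset ι) : ∑ i ∈ s, v i = ∑ i, if i ∈ s then v i else 0 := by simp
  rw [sum_congr rfl fun s _ => h s]
  rw [sum_comm, smul_sum, smul_sum]
  refine sum_congr rfl fun i _ => ?_
  rw [← sum_filter, sum_const, ← Nat.cast_smul_eq_nsmul ℝ, smul_smul]
  congr 1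
  exact_mod_cast card_mul_card_filter_mem_powersetCard n i

lemma card_mul_sum_powersetCard_norm_sum_sq (n : ℕ) (v : ι → E) :
    (Fintype.card ι : ℝ) * (Fintype.card ι - 1)
        * ∑ s ∈ powersetCard n (univ : Finset ι), ‖∑ i ∈ s, v i‖ ^ 2
      = (Fintype.card ι).choose n * n * (n - 1) * ‖∑ i, v i‖ ^ 2
        + (Fintype.card ι).choose n * n * (Fintype.card ι - n) * ∑ i, ‖v i‖ ^ 2 := by
  have hsq (s : Finset ι) : ‖∑ i ∈ s, v i‖ ^ 2
      = ∑ i, ∑ j, if i ∈ s ∧ j ∈ s then inner ℝ (v i) (v j) else 0 := by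
    rw [← real_inner_self_eq_norm_sq, sum_inner]
    simp [inner_sum, ite_and]
  have hswap : ∑ s ∈ powersetCard n (univ : Finset ι), ‖∑ i ∈ s, v i‖ ^ 2
      = ∑ i, ∑ j, (#{s ∈ powersetCard n (univ : Finset ι) | i ∈ s ∧ j ∈ s} : ℝ)
          * inner ℝ (v i) (v j) := by
    simp_rw [hsq]
    rw [sum_comm]
    refine sum_congr rfl fun i _ => ?_
    rw [sum_comm]
    refine sum_congr rfl fun j _ => ?_
    rw [← sum_filter, sum_const, nsmul_eq_mul]
  rw [hswap, hsq univ]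
  simp_rw [mul_sum, ← mul_assoc, card_mul_card_filter_mem_mem_powersetCard, add_mul,
    sum_add_distrib, ite_mul, zero_mul, sum_ite_eq]
  simp

/-- The variance of the rescaled sum over a uniform random `n`-subset, drawn without
replacement. -/
lemma sub_one_mul_sum_powersetCard_norm_sub_sq {n : ℕ} (hn : n ≠ 0) (v : ι → E) :
    ((Fintype.card ι : ℝ) - 1) * ∑ s ∈ powersetCard n (univ : Finset ι),
        ‖((Fintype.card ι : ℝ) / n) • (∑ i ∈ s, v i) - ∑ i, v i‖ ^ 2
      = (Fintype.card ι).choose n * (((Fintype.card ι : ℝ) - n) / n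
        * (Fintype.card ι * ∑ i, ‖v i‖ ^ 2 - ‖∑ i, v i‖ ^ 2)) := by
  have hn' : (n : ℝ) ≠ 0 := Nat.cast_ne_zero.2 hn
  have hQ := card_mul_sum_powersetCard_norm_sum_sq n v
  have hL := congrArg (inner ℝ · (∑ i, v i)) (card_smul_sum_powersetCard_sum n v)
  simp only [real_inner_smul_left, real_inner_self_eq_norm_sq, sum_inner (powersetCard n univ)]
    at hL
  simp_rw [norm_sub_sq_real, norm_smul, mul_pow, real_inner_smul_left, Real.norm_eq_abs, sq_abs,
    sum_add_distrib, sum_sub_distrib, ← mul_sum, sum_const, card_powersetCard, card_univ,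
    nsmul_eq_mul]
  field_simp
  linear_combination (Fintype.card ι : ℝ) * hQ - 2 * ((Fintype.card ι : ℝ) - 1) * n * hL

end SubsetSums

/-- Second moment of the naive stochastic-gradient error under Assumption S3: with
`U = ∑ᵢ Uᵢ`, each `∇Uᵢ` being `M̃`-Lipschitz with `∇Uᵢ(xᵢ*) = 0`, and `τ` a uniform random
`n`-subset of `{1, …, N}` (modelled as the average over all `n`-element subsets of `Fin N`),
`E_τ |(N/n)·∑_{i∈τ} ∇Uᵢ(x) − ∇U(x)|² ≤ 2·((N−n)/n)·M̃²·∑ᵢ |x − xᵢ*|²`. -/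
theorem naive_subsampled_gradient_second_moment
    {d N : ℕ} (U : Fin N → EuclideanSpace ℝ (Fin d) → ℝ)
    (hU : ∀ i, Differentiable ℝ (U i))
    (Mt : ℝ) (hMt : 0 < Mt)
    (hS3 : ∀ i, ∀ x y : EuclideanSpace ℝ (Fin d),
      ‖gradient (U i) x - gradient (U i) y‖ ≤ Mt * ‖x - y‖)
    (xs : Fin N → EuclideanSpace ℝ (Fin d)) (hxs : ∀ i, gradient (U i) (xs i) = 0)
    (n : ℕ) (hn1 : 1 ≤ n) (hnN : n ≤ N) (x : EuclideanSpace ℝ (Fin d)) :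
    (N.choose n : ℝ)⁻¹ *
        ∑ s ∈ Finset.powersetCard n (Finset.univ : Finset (Fin N)),
          ‖((N : ℝ) / n) • (∑ i ∈ s, gradient (U i) x)
              - gradient (fun z => ∑ i, U i z) x‖ ^ 2
      ≤ 2 * (((N : ℝ) - n) / n) * Mt ^ 2 * ∑ i, ‖x - xs i‖ ^ 2 := by
  rw [gradient_fun_sum fun i => hU i x]
  have hn : (0 : ℝ) < n := by exact_mod_cast hn1
  have hNn : (0 : ℝ) ≤ (N : ℝ) - n := sub_nonneg.2 (by exact_mod_cast hnN)
  have hgrad : ∑ i, ‖gradient (U i) x‖ ^ 2 ≤ Mt ^ 2 * ∑ i, ‖x - xs i‖ ^ 2 := by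
    rw [mul_sum]
    refine sum_le_sum fun i _ => ?_
    rw [← mul_pow]
    gcongr
    simpa [hxs i] using hS3 i x (xs i)
  obtain rfl | hlt := hnN.eq_or_lt
  · have hpow : powersetCard n (univ : Finset (Fin n)) = {univ} := by
      simpa using powersetCard_self (univ : Finset (Fin n))
    simp [hpow, hn.ne']
  have hvar := sub_one_mul_sum_powersetCard_norm_sub_sq (Nat.one_le_iff_ne_zero.1 hn1)
    fun i => gradient (U i) x
  simp only [Fintype.card_fin] at hvar
  have hC : (0 : ℝ) < N.choose n := by exact_mod_cast Nat.choose_pos hnN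
  have hN : (2 : ℝ) ≤ N := by exact_mod_cast hn1.trans_lt hlt
  rw [inv_mul_le_iff₀ hC]
  refine le_of_mul_le_mul_left (hvar.trans_le ?_) (by linarith : (0 : ℝ) < (N : ℝ) - 1)
  have hle : (N : ℝ) * ∑ i, ‖gradient (U i) x‖ ^ 2 - ‖∑ i, gradient (U i) x‖ ^ 2
      ≤ 2 * (N - 1) * (Mt ^ 2 * ∑ i, ‖x - xs i‖ ^ 2) := by
    have hpos : 0 ≤ ∑ i, ‖gradient (U i) x‖ ^ 2 := sum_nonneg fun i _ => sq_nonneg _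
    nlinarith [sq_nonneg ‖∑ i, gradient (U i) x‖]
  calc _ ≤ N.choose n * (((N : ℝ) - n) / n
        * (2 * (N - 1) * (Mt ^ 2 * ∑ i, ‖x - xs i‖ ^ 2))) := by gcongr
    _ = _ := by ring
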